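/- Let I ⊆ ℝ be an open interval and let u : ℝ × ℝ → ℝ be smooth, spatially periodic, and satisfy the μBurgers equation u_txx + 3u_x u_xx + u u_xxx = 0 for all t ∈ I and x ∈ ℝ. Then for every natural number p ≥ 1, the integral t ↦ ∫₀¹ ( u(t,x) − μ(u)(t) )^p dx is constant on I, where μ(u)(t) = ∫₀¹ u(t,y) dy. -/

import Mathlib

open intervalIntegral

/-- Partial derivative in the second (spatial) variable. -/
noncomputable def pdx (u : ℝ × ℝ → ℝ) : ℝ × ℝ → ℝ := fun p => deriv (fun y => u (p.1, y)) p.2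

/-- Partial derivative in the first (time) variable. -/
noncomputable def pdt (u : ℝ × ℝ → ℝ) : ℝ × ℝ → ℝ := fun p => deriv (fun s => u (s, p.2)) p.1

/-- The spatial mean `μ(u)(t) = ∫₀¹ u(t,x) dx`. -/
noncomputable def muMean (u : ℝ × ℝ → ℝ) (t : ℝ) : ℝ := ∫ x in (0:ℝ)..1, u (t, x)

theorem hasDerivAt_pdx {g : ℝ × ℝ → ℝ} (hg : ContDiff ℝ (⊤ : ℕ∞) g) (t x : ℝ) :
    HasDerivAt (fun y => g (t, y)) (pdx g (t, x)) x := by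
  have h : Differentiable ℝ (fun y => g (t, y)) :=
    (hg.comp (contDiff_const.prodMk contDiff_id)).differentiable (by simp)
  exact (h x).hasDerivAt

theorem hasDerivAt_pdt {g : ℝ × ℝ → ℝ} (hg : ContDiff ℝ (⊤ : ℕ∞) g) (t x : ℝ) :
    HasDerivAt (fun s => g (s, x)) (pdt g (t, x)) t := by
  have h : Differentiable ℝ (fun s => g (s, x)) :=
    (hg.comp (contDiff_id.prodMk contDiff_const)).differentiable (by simp)
  exact (h t).hasDerivAt

theorem contDiff_pdx {g : ℝ × ℝ → ℝ} (hg : ContDiff ℝ (⊤ : ℕ∞) g) :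
    ContDiff ℝ (⊤ : ℕ∞) (pdx g) := by
  have h : pdx g = fun q => fderiv ℝ g q (0, 1) := by
    funext ⟨t, x⟩
    have hd := (hg.differentiable (by simp) (t, x)).hasFDerivAt
    exact (hd.comp_hasDerivAt x ((hasDerivAt_const x t).prodMk (hasDerivAt_id x))).deriv
  rw [h]
  exact (hg.fderiv_right (m := (⊤ : ℕ∞)) (by simp)).clm_apply contDiff_const

theorem contDiff_pdt {g : ℝ × ℝ → ℝ} (hg : ContDiff ℝ (⊤ : ℕ∞) g) :
    ContDiff ℝ (⊤ : ℕ∞) (pdt g) := by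
  have h : pdt g = fun q => fderiv ℝ g q (1, 0) := by
    funext ⟨t, x⟩
    have hd := (hg.differentiable (by simp) (t, x)).hasFDerivAt
    exact (hd.comp_hasDerivAt t ((hasDerivAt_id t).prodMk (hasDerivAt_const t x))).deriv
  rw [h]
  exact (hg.fderiv_right (m := (⊤ : ℕ∞)) (by simp)).clm_apply contDiff_const

/-- Differentiation under the integral sign over a compact interval. -/
theorem hasDerivAt_intervalIntegral_of_continuous {f f' : ℝ → ℝ → ℝ} {a b : ℝ}
    (hf : ∀ t, Continuous (f t)) (hf' : Continuous (Function.uncurry f'))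
    (h : ∀ t x, HasDerivAt (fun s => f s x) (f' t x) t) (t : ℝ) :
    HasDerivAt (fun s => ∫ x in a..b, f s x) (∫ x in a..b, f' t x) t := by
  obtain ⟨C, hC⟩ := ((isCompact_closedBall t 1).prod
    (isCompact_uIcc (a := a) (b := b))).exists_bound_of_continuousOn hf'.continuousOn
  refine (hasDerivAt_integral_of_dominated_loc_of_deriv_le (bound := fun _ => C)
    (Metric.closedBall_mem_nhds t one_pos) (.of_forall fun s => (hf s).aestronglyMeasurable)
    ((hf t).intervalIntegrable a b)
    (hf'.comp (Continuous.prodMk_right t)).aestronglyMeasurable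
    (.of_forall fun x hx s hs => hC (s, x) ⟨hs, Set.uIoc_subset_uIcc hx⟩)
    intervalIntegrable_const (.of_forall fun x _ s _ => h s x)).2

/-- A periodic function with vanishing second derivative is constant. -/
theorem eq_const_of_periodic_of_deriv_deriv_eq_zero {f f' : ℝ → ℝ}
    (hf : ∀ x, HasDerivAt f (f' x) x) (hf' : ∀ x, HasDerivAt f' 0 x)
    (hper : ∀ x, f (x + 1) = f x) (x y : ℝ) : f x = f y := by
  have hc : ∀ z, f' z = f' 0 := fun z =>
    is_const_of_deriv_eq_zero (fun w => (hf' w).differentiableAt) (fun w => (hf' w).deriv) z 0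
  have hlin : ∀ z, HasDerivAt (fun w => f w - f' 0 * w) 0 z := fun z => by
    exact ((hf z).sub ((hasDerivAt_id z).const_mul (f' 0))).congr_deriv (by simp [hc z])
  have haff : ∀ z w, f z - f' 0 * z = f w - f' 0 * w := fun z w =>
    is_const_of_deriv_eq_zero (fun w => (hlin w).differentiableAt) (fun w => (hlin w).deriv) z w
  have h0 : f' 0 = 0 := by linarith [haff (0 + 1) 0, hper 0]
  simpa [h0] using haff x y

theorem pdx_periodic {u : ℝ × ℝ → ℝ} (hper : ∀ t x, u (t, x + 1) = u (t, x)) (t x : ℝ) :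
    pdx u (t, x + 1) = pdx u (t, x) := by
  simp only [pdx]
  rw [← deriv_comp_add_const]
  simp only [hper]

theorem pdt_periodic {u : ℝ × ℝ → ℝ} (hper : ∀ t x, u (t, x + 1) = u (t, x)) (t x : ℝ) :
    pdt u (t, x + 1) = pdt u (t, x) := by
  simp only [pdt, hper]

/-- The μBurgers equation says that `u_t + u u_x` does not depend on `x`. -/
theorem muBurgers_pdt_add_mul_pdx_eq {u : ℝ × ℝ → ℝ} (hu : ContDiff ℝ (⊤ : ℕ∞) u)
    (hper : ∀ t x, u (t, x + 1) = u (t, x)) {t : ℝ}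
    (heq : ∀ x : ℝ, pdx (pdx (pdt u)) (t, x) + 3 * pdx u (t, x) * pdx (pdx u) (t, x)
        + u (t, x) * pdx (pdx (pdx u)) (t, x) = 0) (x y : ℝ) :
    pdt u (t, x) + u (t, x) * pdx u (t, x) = pdt u (t, y) + u (t, y) * pdx u (t, y) := by
  have hut := contDiff_pdt hu
  have hux := contDiff_pdx hu
  have huxx := contDiff_pdx hux
  refine eq_const_of_periodic_of_deriv_deriv_eq_zero
    (f := fun x => pdt u (t, x) + u (t, x) * pdx u (t, x))
    (fun x => (hasDerivAt_pdx hut t x).add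
      ((hasDerivAt_pdx hu t x).mul (hasDerivAt_pdx hux t x)))
    (fun x => ?_) (fun x => ?_) x y
  · refine ((hasDerivAt_pdx (contDiff_pdx hut) t x).add
      (((hasDerivAt_pdx hux t x).mul (hasDerivAt_pdx hux t x)).add
        ((hasDerivAt_pdx hu t x).mul (hasDerivAt_pdx huxx t x)))).congr_deriv ?_
    linarith [heq x]
  · simp only [pdt_periodic hper, hper, pdx_periodic hper]

theorem hasDerivAt_muMean {u : ℝ × ℝ → ℝ} (hu : ContDiff ℝ (⊤ : ℕ∞) u) (t : ℝ) :
    HasDerivAt (muMean u) (muMean (pdt u) t) t :=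
  hasDerivAt_intervalIntegral_of_continuous (f := fun t x => u (t, x))
    (f' := fun t x => pdt u (t, x)) (fun t => hu.continuous.comp (Continuous.prodMk_right t))
    (contDiff_pdt hu).continuous (fun t x => hasDerivAt_pdt hu t x) t

theorem continuous_muMean {u : ℝ × ℝ → ℝ} (hu : Continuous u) : Continuous (muMean u) :=
  continuous_parametric_intervalIntegral_of_continuous' (f := fun t x => u (t, x)) hu 0 1

/-- Under the μBurgers equation, `u_t - μ(u_t) = -u u_x`. -/
theorem muBurgers_pdt_sub_muMean {u : ℝ × ℝ → ℝ} (hu : ContDiff ℝ (⊤ : ℕ∞) u)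
    (hper : ∀ t x, u (t, x + 1) = u (t, x)) {t : ℝ}
    (heq : ∀ x : ℝ, pdx (pdx (pdt u)) (t, x) + 3 * pdx u (t, x) * pdx (pdx u) (t, x)
        + u (t, x) * pdx (pdx (pdx u)) (t, x) = 0) (x : ℝ) :
    pdt u (t, x) - muMean (pdt u) t = -(u (t, x) * pdx u (t, x)) := by
  have hcu : Continuous fun y => u (t, y) := hu.continuous.comp (Continuous.prodMk_right t)
  have hcx : Continuous fun y => pdx u (t, y) :=
    (contDiff_pdx hu).continuous.comp (Continuous.prodMk_right t)
  have hmul : Continuous fun y => u (t, y) * pdx u (t, y) := hcu.mul hcx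
  have hint : ∫ y in (0:ℝ)..1, u (t, y) * pdx u (t, y) = 0 := by
    rw [integral_eq_sub_of_hasDerivAt (f := fun y => u (t, y) ^ 2 / 2)
      (fun y _ => ?_) (hmul.intervalIntegrable _ _)]
    · simpa [sub_eq_zero] using congrArg (fun z => z ^ 2) (hper t 0)
    · refine (((hasDerivAt_pdx hu t y).pow 2).div_const 2).congr_deriv ?_
      push_cast
      ring
  have hmean : muMean (pdt u) t = pdt u (t, x) + u (t, x) * pdx u (t, x) := by
    have h : ∀ y, pdt u (t, y)
        = (pdt u (t, x) + u (t, x) * pdx u (t, x)) - u (t, y) * pdx u (t, y) := fun y => by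
      linarith [muBurgers_pdt_add_mul_pdx_eq hu hper heq x y]
    simp only [muMean]
    rw [integral_congr fun y _ => h y, integral_sub intervalIntegrable_const
      (hmul.intervalIntegrable _ _), hint]
    simp
  linarith

theorem hasDerivAt_moment {u : ℝ × ℝ → ℝ} (hu : ContDiff ℝ (⊤ : ℕ∞) u) (p : ℕ) (t : ℝ) :
    HasDerivAt (fun s => ∫ x in (0:ℝ)..1, (u (s, x) - muMean u s) ^ p)
      (∫ x in (0:ℝ)..1, p * (u (t, x) - muMean u t) ^ (p - 1)
        * (pdt u (t, x) - muMean (pdt u) t)) t := by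
  have hut := (contDiff_pdt hu).continuous
  have hcu := hu.continuous
  have hm := continuous_muMean hcu
  have hm' := continuous_muMean hut
  refine hasDerivAt_intervalIntegral_of_continuous (f := fun s x => (u (s, x) - muMean u s) ^ p)
    (f' := fun t x => p * (u (t, x) - muMean u t) ^ (p - 1)
        * (pdt u (t, x) - muMean (pdt u) t)) (fun s => by fun_prop) ?_
    (fun s x => ((hasDerivAt_pdt hu s x).sub (hasDerivAt_muMean hu s)).pow p) t
  simp only [Function.uncurry_def]
  fun_prop

theorem muBurgers_hasDerivAt_moment_zero {u : ℝ × ℝ → ℝ} (hu : ContDiff ℝ (⊤ : ℕ∞) u)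
    (hper : ∀ t x, u (t, x + 1) = u (t, x)) {t : ℝ}
    (heq : ∀ x : ℝ, pdx (pdx (pdt u)) (t, x) + 3 * pdx u (t, x) * pdx (pdx u) (t, x)
        + u (t, x) * pdx (pdx (pdx u)) (t, x) = 0) (n : ℕ) :
    HasDerivAt (fun s => ∫ x in (0:ℝ)..1, (u (s, x) - muMean u s) ^ (n + 1)) 0 t := by
  have hux := (contDiff_pdx hu).continuous
  have hcu := hu.continuous
  convert hasDerivAt_moment hu (n + 1) t using 1
  simp only [muBurgers_pdt_sub_muMean hu hper heq]
  have hn : ((n : ℝ) + 1 + 1) ≠ 0 := by positivity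
  rw [integral_eq_sub_of_hasDerivAt
    (f := fun x => -((n + 1) / (n + 1 + 1) * (u (t, x) - muMean u t) ^ (n + 1 + 1)
      + muMean u t * (u (t, x) - muMean u t) ^ (n + 1)))
    (fun x _ => ?_) (Continuous.intervalIntegrable (by fun_prop) _ _)]
  · have h := hper t 0
    rw [zero_add] at h
    simp only [h, sub_self]
  · have hv := (hasDerivAt_pdx hu t x).sub_const (muMean u t)
    refine (((hv.pow (n + 1 + 1)).const_mul (((n : ℝ) + 1) / (n + 1 + 1))).add
      ((hv.pow (n + 1)).const_mul (muMean u t))).neg.congr_deriv ?_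
    push_cast
    field_simp
    ring

/-- all moments `∫₀¹ (u − μ(u))^p dx`, p ≥ 1, are conserved by the
μBurgers flow. -/
theorem muBurgers_conserved_moments
    (I : Set ℝ) (hIopen : IsOpen I) (hIconv : Convex ℝ I)
    (u : ℝ × ℝ → ℝ) (hu : ContDiff ℝ (⊤ : ℕ∞) u)
    (hper : ∀ t x, u (t, x + 1) = u (t, x))
    (heq : ∀ t ∈ I, ∀ x : ℝ,
      pdx (pdx (pdt u)) (t, x) + 3 * pdx u (t, x) * pdx (pdx u) (t, x)
        + u (t, x) * pdx (pdx (pdx u)) (t, x) = 0) :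
    ∀ p : ℕ, 1 ≤ p → ∀ t₁ ∈ I, ∀ t₂ ∈ I,
      (∫ x in (0:ℝ)..1, (u (t₁, x) - muMean u t₁) ^ p)
        = ∫ x in (0:ℝ)..1, (u (t₂, x) - muMean u t₂) ^ p := by
  intro p hp t₁ h₁ t₂ h₂
  obtain ⟨n, rfl⟩ := Nat.exists_eq_add_of_le' hp
  have hd := fun t (ht : t ∈ I) => muBurgers_hasDerivAt_moment_zero hu hper (heq t ht) n
  exact hIopen.is_const_of_deriv_eq_zero hIconv.isPreconnected
    (fun t ht => (hd t ht).differentiableAt.differentiableWithinAt)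
    (fun t ht => (hd t ht).deriv) h₁ h₂
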